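/- arXiv:1504.01790 — 8 statements merged into one kernel-verified Lean document; each statement's English description precedes it below -/
import Mathlib

section
/- Let X be an infinite topological space. Then |X| ≤ nh(X)^(c(X)·χ(X)), where the exponent is the product of the cellularity and the character of X (cardinal exponentiation). -/
open Cardinal Set

/-- A nonempty subset `A` of a topological space is finitely non-Hausdorff if for every
nonempty finite subset `F` of `A` and every choice of open neighborhoods of the points
of `F`, the intersection of these neighborhoods is nonempty. -/
def FinNonHausdorff (X : Type*) [TopologicalSpace X] (A : Set X) : Prop :=
  A.Nonempty ∧ ∀ F : Finset X, (F : Set X) ⊆ A → F.Nonempty →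
    ∀ U : X → Set X, (∀ x ∈ F, IsOpen (U x) ∧ x ∈ U x) →
      (⋂ x ∈ F, U x).Nonempty

/-- A maximal finitely non-Hausdorff subset. -/
def MaxFinNonHausdorff (X : Type*) [TopologicalSpace X] (A : Set X) : Prop :=
  FinNonHausdorff X A ∧ ∀ B : Set X, FinNonHausdorff X B → A ⊆ B → A = B

/-- The non-Hausdorff number `nh(X)`. -/
noncomputable def nh (X : Type*) [TopologicalSpace X] : Cardinal :=
  1 + ⨆ A : {A : Set X // FinNonHausdorff X A}, #A.1

/-- A nonempty subset `A` is finitely non-Urysohn if for every nonempty finite subset `F`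
of `A` and every choice of open neighborhoods of the points of `F`, the intersection of
the closures of these neighborhoods is nonempty. -/
def FinNonUrysohn (X : Type*) [TopologicalSpace X] (A : Set X) : Prop :=
  A.Nonempty ∧ ∀ F : Finset X, (F : Set X) ⊆ A → F.Nonempty →
    ∀ U : X → Set X, (∀ x ∈ F, IsOpen (U x) ∧ x ∈ U x) →
      (⋂ x ∈ F, closure (U x)).Nonempty

/-- The non-Urysohn number `nu(X)`. -/
noncomputable def nu (X : Type*) [TopologicalSpace X] : Cardinal :=
  1 + ⨆ A : {A : Set X // FinNonUrysohn X A}, #A.1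

/-- The θ-closure of the singleton `{x}`. -/
def thetaClosSingleton (X : Type*) [TopologicalSpace X] (x : X) : Set X :=
  {y | ∀ U : Set X, IsOpen U → y ∈ U → x ∈ closure U}

/-- The non-Urysohn number of `X` with respect to singletons, `nu_s(X)`. -/
noncomputable def nuS (X : Type*) [TopologicalSpace X] : Cardinal :=
  1 + ⨆ x : X, #(thetaClosSingleton X x)

/-- The cellularity `c(X)`. -/
noncomputable def cellularity (X : Type*) [TopologicalSpace X] : Cardinal :=
  ℵ₀ + ⨆ 𝒰 : {𝒰 : Set (Set X) //
      (∀ U ∈ 𝒰, IsOpen U ∧ U.Nonempty) ∧ 𝒰.PairwiseDisjoint id}, #𝒰.1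

/-- The character `χ(X)`. -/
noncomputable def character (X : Type*) [TopologicalSpace X] : Cardinal :=
  ⨆ x : X, sInf {c : Cardinal | ∃ B : Set (Set X), #B = c ∧
    (∀ U ∈ B, IsOpen U ∧ x ∈ U) ∧ ∀ V : Set X, IsOpen V → x ∈ V → ∃ U ∈ B, U ⊆ V}

/-- The spread `s(X)`. -/
noncomputable def spread (X : Type*) [TopologicalSpace X] : Cardinal :=
  ℵ₀ + ⨆ D : {D : Set X // DiscreteTopology D}, #D.1

/-- The pseudocharacter `ψ(X)` of a `T₁` space. -/
noncomputable def pseudoCharacter (X : Type*) [TopologicalSpace X] : Cardinal :=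
  ⨆ x : X, sInf {c : Cardinal | ∃ S : Set (Set X), #S = c ∧
    (∀ U ∈ S, IsOpen U) ∧ ⋂₀ S = {x}}

universe u

/-- A transfinite closing-off argument: a set of size at most `μ` closed under `μ` many operations
of arity `K`, as long as `μ ^ #K ≤ μ`. -/
lemma exists_closed_under_ops {L K X : Type u} [Nonempty X] (op : L → (K → X) → X)
    {μ : Cardinal.{u}} (hμ : ℵ₀ ≤ μ) (hL : #L ≤ μ) (hK : μ ^ #K ≤ μ) :
    ∃ A : Set X, A.Nonempty ∧ #A ≤ μ ∧ ∀ l f, (∀ k, f k ∈ A) → op l f ∈ A := by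
  let β : Option L → Type u := fun o => o.elim PEmpty fun _ => K
  let x₀ : X := Classical.arbitrary X
  let e : WType β → X := WType.elim X fun p => match p with
    | ⟨none, _⟩ => x₀
    | ⟨some l, f⟩ => op l f
  have hW : #(WType β) ≤ μ := by
    refine WType.cardinalMk_le_of_le' ?_
    calc (sum fun a : Option L => μ ^ lift.{u} #(β a)) ≤ sum fun _ : Option L => μ := by
          refine sum_le_sum _ _ fun a => ?_
          cases a with
          | none => simpa [β] using one_le_aleph0.trans hμ
          | some l => simpa [β] using hK
      _ = #(Option L) * μ := by simp
      _ ≤ μ * μ := by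
          gcongr
          rw [mk_option]
          exact add_le_of_le hμ hL (one_le_aleph0.trans hμ)
      _ = μ := mul_eq_self hμ
  refine ⟨range e, ⟨_, WType.mk none PEmpty.elim, rfl⟩, mk_range_le.trans hW, fun l f hf => ?_⟩
  choose g hg using hf
  refine ⟨WType.mk (some l) g, ?_⟩
  change op l (fun k => e (g k)) = op l f
  congr 1
  exact funext hg

lemma exists_range_between {N X : Type u} {s : Set X} (hs : #s ≤ #N) (d : X) :
    ∃ g : N → X, s ⊆ range g ∧ range g ⊆ insert d s := by
  obtain ⟨i⟩ := hs
  refine ⟨Function.extend i Subtype.val fun _ => d, fun x hx => ⟨i ⟨x, hx⟩, ?_⟩, ?_⟩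
  · exact i.injective.extend_apply _ _ _
  · rintro _ ⟨n, rfl⟩
    by_cases h : ∃ a, i a = n
    · obtain ⟨a, rfl⟩ := h
      rw [i.injective.extend_apply]
      exact Or.inr a.2
    · rw [Function.extend_apply' _ _ _ h]
      exact Or.inl rfl

lemma mk_le_nh {X : Type u} [TopologicalSpace X] {A : Set X} (hA : FinNonHausdorff X A) :
    #A ≤ nh X :=
  (le_ciSup (f := fun A : {A : Set X // FinNonHausdorff X A} => #A.1)
    bddAbove_of_small ⟨A, hA⟩).trans le_add_self

lemma two_le_nh (X : Type u) [TopologicalSpace X] [Nonempty X] : 2 ≤ nh X := by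
  let x : X := Classical.arbitrary X
  have hx : FinNonHausdorff X {x} := by
    refine ⟨singleton_nonempty x, fun F hF _ U hU => ⟨x, ?_⟩⟩
    simp only [mem_iInter]
    intro y hy
    have hyx : y = x := hF hy
    exact hyx ▸ (hU y hy).2
  rw [← one_add_one_eq_two, nh]
  gcongr
  simpa using le_ciSup (f := fun A : {A : Set X // FinNonHausdorff X A} => #A.1)
    bddAbove_of_small ⟨{x}, hx⟩

lemma aleph0_le_cellularity (X : Type u) [TopologicalSpace X] : ℵ₀ ≤ cellularity X :=
  le_self_add

lemma mk_le_cellularity {X : Type u} [TopologicalSpace X] {𝒰 : Set (Set X)}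
    (h : ∀ U ∈ 𝒰, IsOpen U ∧ U.Nonempty) (hd : 𝒰.PairwiseDisjoint id) :
    #𝒰 ≤ cellularity X :=
  (le_ciSup (f := fun 𝒰 : {𝒰 : Set (Set X) //
      (∀ U ∈ 𝒰, IsOpen U ∧ U.Nonempty) ∧ 𝒰.PairwiseDisjoint id} => #𝒰.1)
    bddAbove_of_small ⟨𝒰, h, hd⟩).trans le_add_self

lemma exists_nhds_basis_mk_le_character {X : Type u} [TopologicalSpace X] (x : X) :
    ∃ B : Set (Set X), #B ≤ character X ∧
      (∀ U ∈ B, IsOpen U ∧ x ∈ U) ∧ ∀ V : Set X, IsOpen V → x ∈ V → ∃ U ∈ B, U ⊆ V := by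
  let C : X → Set Cardinal.{u} := fun x => {c | ∃ B : Set (Set X), #B = c ∧
    (∀ U ∈ B, IsOpen U ∧ x ∈ U) ∧ ∀ V : Set X, IsOpen V → x ∈ V → ∃ U ∈ B, U ⊆ V}
  have hne : (C x).Nonempty :=
    ⟨_, {U | IsOpen U ∧ x ∈ U}, rfl, fun _ h => h, fun V hV hx => ⟨V, ⟨hV, hx⟩, Subset.rfl⟩⟩
  obtain ⟨B, hB, h⟩ := csInf_mem hne
  exact ⟨B, hB.trans_le (le_ciSup (f := fun x => sInf (C x)) bddAbove_of_small x), h⟩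

lemma one_le_character (X : Type u) [TopologicalSpace X] [Nonempty X] : 1 ≤ character X := by
  obtain ⟨B, hB, -, h⟩ := exists_nhds_basis_mk_le_character (Classical.arbitrary X)
  obtain ⟨U, hU, -⟩ := h univ isOpen_univ (mem_univ _)
  have : Nonempty B := ⟨⟨U, hU⟩⟩
  exact (Cardinal.one_le_iff_ne_zero.2 (mk_ne_zero B)).trans hB

/-- `b x` enumerates a basis of open neighborhoods of `x`, for every point `x`. -/
def IsNhdsSystem {X K : Type u} [TopologicalSpace X] (b : X → K → Set X) : Prop :=
  (∀ x k, IsOpen (b x k) ∧ x ∈ b x k) ∧ ∀ x V, IsOpen V → x ∈ V → ∃ k, b x k ⊆ V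

lemma exists_isNhdsSystem {X K : Type u} [TopologicalSpace X] (hK : character X ≤ #K) :
    ∃ b : X → K → Set X, IsNhdsSystem b := by
  have key (x : X) : ∃ g : K → Set X,
      (∀ k, IsOpen (g k) ∧ x ∈ g k) ∧ ∀ V, IsOpen V → x ∈ V → ∃ k, g k ⊆ V := by
    obtain ⟨B, hB, hBo, hBb⟩ := exists_nhds_basis_mk_le_character x
    obtain ⟨g, hg, hg'⟩ := exists_range_between (hB.trans hK) univ
    refine ⟨g, fun k => ?_, fun V hV hx => ?_⟩
    · rcases hg' (mem_range_self k) with h | h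
      · rw [h]
        exact ⟨isOpen_univ, mem_univ x⟩
      · exact hBo _ h
    · obtain ⟨U, hU, hUV⟩ := hBb V hV hx
      obtain ⟨k, rfl⟩ := hg hU
      exact ⟨k, hUV⟩
  choose b hb hb' using key
  exact ⟨b, hb, hb'⟩

/-- Every family of open sets has a subfamily of size at most the cellularity whose union is
dense in the union of the whole family. -/
lemma exists_subfamily_dense {X ι : Type u} [TopologicalSpace X] (O : ι → Set X)
    (hO : ∀ i, IsOpen (O i)) (J : Set ι) :
    ∃ T ⊆ J, #T ≤ cellularity X ∧ ∀ i ∈ J, O i ⊆ closure (⋃ t ∈ T, O t) := by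
  rcases isEmpty_or_nonempty ι with _ | _
  · exact ⟨∅, empty_subset _, by simp, fun i => isEmptyElim i⟩
  let S : Set (Set (Set X)) := {𝒰 | (∀ U ∈ 𝒰, (IsOpen U ∧ U.Nonempty) ∧ ∃ i ∈ J, U ⊆ O i) ∧
    𝒰.PairwiseDisjoint id}
  obtain ⟨𝒰, h𝒰⟩ : ∃ 𝒰, Maximal (· ∈ S) 𝒰 := by
    refine zorn_subset S fun c hc hchain => ⟨⋃₀ c, ⟨?_, ?_⟩, fun s hs => subset_sUnion_of_mem hs⟩
    · rintro U ⟨s, hs, hU⟩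
      exact (hc hs).1 U hU
    · exact (pairwiseDisjoint_sUnion hchain.directedOn).2 fun s hs => (hc hs).2
  choose! t htJ ht using fun U hU => (h𝒰.prop.1 U hU).2
  refine ⟨t '' 𝒰, image_subset_iff.2 htJ,
    mk_image_le.trans (mk_le_cellularity (fun U hU => (h𝒰.prop.1 U hU).1) h𝒰.prop.2), ?_⟩
  intro i hi
  by_contra hsub
  let Y := O i \ closure (⋃ j ∈ t '' 𝒰, O j)
  have hYdisj : ∀ U ∈ 𝒰, Disjoint Y U := fun U hU =>
    disjoint_left.2 fun y hy hyU => hy.2 <| subset_closure <|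
      mem_biUnion (mem_image_of_mem t hU) (ht U hU hyU)
  have hYne : Y.Nonempty := sdiff_nonempty.2 hsub
  have hins : insert Y 𝒰 ∈ S := by
    refine ⟨?_, ?_⟩
    · rintro U (rfl | hU)
      · exact ⟨⟨(hO i).sdiff isClosed_closure, hYne⟩, i, hi, sdiff_subset⟩
      · exact h𝒰.prop.1 U hU
    · exact h𝒰.prop.2.insert fun U hU _ => hYdisj U hU
  have hY : Y ∈ 𝒰 := h𝒰.le_of_ge hins (subset_insert _ _) (mem_insert _ _)
  exact hYne.ne_empty (disjoint_self.1 (hYdisj Y hY))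

/-- Intersections of finitely many neighborhoods of points of `H` meet every member of `W`. -/
def FinMeets {X K : Type u} [TopologicalSpace X] (W : K → Set X) (H : Set X) : Prop :=
  ∀ F : Finset X, (F : Set X) ⊆ H → ∀ U : X → Set X, (∀ x ∈ F, IsOpen (U x) ∧ x ∈ U x) →
    ∀ k, ((⋂ x ∈ F, U x) ∩ W k).Nonempty

lemma FinMeets.mk_le_nh {X K : Type u} [TopologicalSpace X] [Nonempty K] {W : K → Set X}
    {H : Set X} (h : FinMeets W H) : #H ≤ nh X := by
  rcases H.eq_empty_or_nonempty with rfl | hne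
  · simp
  · exact _root_.mk_le_nh ⟨hne, fun F hF _ U hU =>
      (h F hF U hU (Classical.arbitrary K)).mono inter_subset_left⟩

lemma exists_maximal_finMeets {X K : Type u} [TopologicalSpace X] {W : K → Set X}
    (h : FinMeets W ∅) : ∃ H, Maximal (FinMeets W) H := by
  have hchain (c) (hc : c ⊆ {H | FinMeets W H}) (hch : IsChain (· ⊆ ·) c) (hne : c.Nonempty) :
      FinMeets W (⋃₀ c) := fun F hF => by
    rw [sUnion_eq_biUnion] at hF
    obtain ⟨s, hs, hFs⟩ := DirectedOn.exists_mem_subset_of_finset_subset_biUnion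
      (f := fun s : Set X => s) hne hch.directedOn hF
    exact hc hs F hFs
  obtain ⟨H, -, hH⟩ := zorn_subset_nonempty {H | FinMeets W H}
    (fun c hc hch hne => ⟨⋃₀ c, hchain c hc hch hne, fun s hs => subset_sUnion_of_mem hs⟩) ∅ h
  exact ⟨H, hH⟩

/-- The intersection of the neighborhoods with indices in `s` of the points named by `f`. -/
def finInter {X I K : Type u} (b : X → K → Set X) (f : I → X) (s : Finset (I × K)) : Set X :=
  ⋂ p ∈ s, b (f p.1) p.2

lemma IsNhdsSystem.isOpen_finInter {X I K : Type u} [TopologicalSpace X] {b : X → K → Set X}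
    (hb : IsNhdsSystem b) (f : I → X) (s : Finset (I × K)) : IsOpen (finInter b f s) :=
  isOpen_biInter_finset fun p _ => (hb.1 (f p.1) p.2).1

/-- The complement of the closure of the union of the finite intersections indexed by `l`. -/
def outerTrace {X K : Type u} [TopologicalSpace X] (b : X → K → Set X) (f : K → X)
    (l : Set (Finset (K × K))) : Set X :=
  (closure (⋃ t ∈ l, finInter b f t))ᶜ

lemma exists_outerTrace {X K : Type u} [TopologicalSpace X] [Infinite K]
    (hK : cellularity X ≤ #K) {b : X → K → Set X} (hb : IsNhdsSystem b) {A : Set X}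
    (hA : A.Nonempty) (V : K → Set X) :
    ∃ f : K → X, (∀ k, f k ∈ A) ∧ ∀ k, ∀ s : Finset (X × K), (∀ p ∈ s, p.1 ∈ A) →
      Disjoint (finInter b id s) (V k) →
      Disjoint (finInter b id s) (outerTrace b f {t | Disjoint (finInter b f t) (V k)}) := by
  classical
  let J : K → Set (Finset (X × K)) := fun k =>
    {s | (∀ p ∈ s, p.1 ∈ A) ∧ Disjoint (finInter b id s) (V k)}
  choose T hTJ hTc hT using fun k =>
    exists_subfamily_dense (finInter b id) (hb.isOpen_finInter id) (J k)
  let S : Set X := ⋃ k, ⋃ s ∈ T k, Prod.fst '' (s : Set (X × K))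
  have hK₀ : ℵ₀ ≤ #K := aleph0_le_mk K
  have hSA : S ⊆ A := by
    simp only [S, iUnion_subset_iff, image_subset_iff]
    exact fun k s hs p hp => (hTJ k hs).1 p hp
  have hS : #S ≤ #K := by
    refine (mk_iUnion_le _).trans ((mul_le_mul' le_rfl (ciSup_le' fun k => ?_)).trans
      (mul_eq_self hK₀).le)
    refine (mk_biUnion_le _ _).trans ((mul_le_mul' ((hTc k).trans hK)
      (ciSup_le' fun s => ?_)).trans (mul_eq_self hK₀).le)
    exact mk_image_le.trans ((lt_aleph0_of_finite _).le.trans hK₀)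
  obtain ⟨d, hd⟩ := hA
  obtain ⟨f, hSf, hfS⟩ := exists_range_between hS d
  refine ⟨f, fun k => insert_subset hd hSA (hfS (mem_range_self k)), fun k s hs hdisj => ?_⟩
  choose! h hh using fun x hx => hSf (a := x) hx
  refine disjoint_compl_right_iff_subset.2 ((hT k s ⟨hs, hdisj⟩).trans (closure_mono ?_))
  refine iUnion₂_subset fun t ht => ?_
  have heq : finInter b f (t.image fun p => (h p.1, p.2)) = finInter b id t := by
    unfold finInter
    rw [Finset.set_biInter_finset_image]
    refine iInter₂_congr fun p hp => ?_
    have hpS : p.1 ∈ S := mem_iUnion.2 ⟨k, mem_biUnion ht ⟨p, hp, rfl⟩⟩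
    simp [hh p.1 hpS]
  rw [← heq]
  refine subset_biUnion_of_mem (u := fun t => finInter b f t) ?_
  simpa [heq] using (hTJ k ht).2

lemma subset_outerTrace {X K : Type u} [TopologicalSpace X] (b : X → K → Set X) (f : K → X)
    {V : Set X} (hV : IsOpen V) :
    V ⊆ outerTrace b f {t | Disjoint (finInter b f t) V} := by
  refine subset_compl_iff_disjoint_left.2 (Disjoint.closure_left ?_ hV)
  exact disjoint_iUnion₂_left.2 fun t ht => ht

/-- If finite intersections of basic neighborhoods of points of `A` that meet `W k` also meet the
basic neighborhood `b q k ⊆ W k`, then `q` can be added to any `H ⊆ A` with `FinMeets W H`. -/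
lemma FinMeets.insert_of_subset {X K : Type u} [TopologicalSpace X] {b : X → K → Set X}
    (hb : IsNhdsSystem b) {A H : Set X} {q : X} {W : K → Set X}
    (hVW : ∀ k, b q k ⊆ W k)
    (hdisj : ∀ k, ∀ s : Finset (X × K), (∀ p ∈ s, p.1 ∈ A) →
      Disjoint (finInter b id s) (b q k) → Disjoint (finInter b id s) (W k))
    (hHA : H ⊆ A) (hH : FinMeets W H) : FinMeets W (insert q H) := by
  classical
  intro F hF U hU k
  have hUopen : IsOpen (⋂ x ∈ F.filter (· = q), U x) :=
    isOpen_biInter_finset fun x hx => (hU x (Finset.mem_filter.1 hx).1).1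
  have hqU : q ∈ ⋂ x ∈ F.filter (· = q), U x := by
    simp only [mem_iInter, Finset.mem_filter]
    rintro x ⟨hx, rfl⟩
    exact (hU x hx).2
  obtain ⟨j, hj⟩ := hb.2 q _ (hUopen.inter (hb.1 q k).1) ⟨hqU, (hb.1 q k).2⟩
  have : Nonempty K := ⟨k⟩
  choose! m hm using fun x hx => hb.2 x (U x) (hU x hx).1 (hU x hx).2
  let G := F.filter (· ≠ q)
  have hGH : (G : Set X) ⊆ H := fun x hx =>
    (hF (Finset.mem_filter.1 hx).1).resolve_left (Finset.mem_filter.1 hx).2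
  let s : Finset (X × K) := G.image fun x => (x, m x)
  have hs : finInter b id s = ⋂ x ∈ G, b x (m x) := by
    simp only [finInter, s, Finset.set_biInter_finset_image, id]
  have hmeet : ¬ Disjoint (finInter b id s) (b q j) := fun hd => by
    have h₁ := hdisj j s (by
      intro p hp
      obtain ⟨x, hx, rfl⟩ := Finset.mem_image.1 hp
      exact hHA (hGH hx)) hd
    rw [hs] at h₁
    exact not_disjoint_iff_nonempty_inter.2 (hH G hGH (fun x => b x (m x))
      (fun x _ => hb.1 x (m x)) j) h₁
  obtain ⟨z, hz, hzq⟩ := not_disjoint_iff.1 hmeet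
  rw [hs] at hz
  refine ⟨z, mem_iInter₂.2 fun x hx => ?_, hVW k (hj hzq).2⟩
  by_cases hxq : x = q
  · exact mem_iInter₂.1 (hj hzq).1 x (Finset.mem_filter.2 ⟨hx, hxq⟩)
  · exact hm x hx (mem_iInter₂.1 hz x (Finset.mem_filter.2 ⟨hx, hxq⟩))

lemma mk_le_nh_power {X K : Type u} [TopologicalSpace X] [Nonempty X] [Infinite K]
    (hc : cellularity X ≤ #K) (hχ : character X ≤ #K) : #X ≤ nh X ^ #K := by
  classical
  obtain ⟨b, hb⟩ := exists_isNhdsSystem hχ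
  have hK₀ : ℵ₀ ≤ #K := aleph0_le_mk K
  let N := (nh X).out
  have hN : #N = nh X := mk_out _
  let x₀ : X := Classical.arbitrary X
  have enum (W : K → Set X) : ∃ e : N → X, FinMeets W ∅ →
      ∃ H ⊆ range e, Maximal (FinMeets W) H := by
    by_cases h : FinMeets W ∅
    · obtain ⟨H, hH⟩ := exists_maximal_finMeets h
      obtain ⟨e, he, -⟩ := exists_range_between (hH.prop.mk_le_nh.trans_eq hN.symm) x₀
      exact ⟨e, fun _ => ⟨H, he, hH⟩⟩
    · exact ⟨fun _ => x₀, fun h' => absurd h' h⟩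
  choose e he using enum
  let op : (K → Set (Finset (K × K))) × N → (K → X) → X := fun l f =>
    e (fun k => outerTrace b f (l.1 k)) l.2
  have h2 : 2 ^ #K ≤ nh X ^ #K := power_le_power_right (two_le_nh X)
  have hμ : ℵ₀ ≤ nh X ^ #K := (hK₀.trans (cantor _).le).trans h2
  have hμK : (nh X ^ #K) ^ #K ≤ nh X ^ #K := by rw [← power_mul, mul_eq_self hK₀]
  have hL : #((K → Set (Finset (K × K))) × N) ≤ nh X ^ #K := by
    have h1 : #(K → Set (Finset (K × K))) = 2 ^ #K := by
      simp only [mk_pi, prod_const, mk_set, mk_finset_of_infinite, mk_prod, lift_id,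
        mul_eq_self hK₀, ← power_mul]
    rw [mk_prod, lift_id, lift_id, h1, hN]
    exact (mul_le_mul' h2 (self_le_power _ (one_le_aleph0.trans hK₀))).trans
      (mul_eq_self hμ).le
  obtain ⟨A, hAne, hAμ, hA⟩ := exists_closed_under_ops op hμ hL hμK
  suffices hAu : A = Set.univ by rwa [hAu, mk_univ] at hAμ
  refine eq_univ_of_forall fun q => ?_
  obtain ⟨f, hfA, hf⟩ := exists_outerTrace hc hb hAne (b q)
  let l : K → Set (Finset (K × K)) := fun k => {t | Disjoint (finInter b f t) (b q k)}
  let W : K → Set X := fun k => outerTrace b f (l k)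
  have hVW (k : K) : b q k ⊆ W k := subset_outerTrace b f (hb.1 q k).1
  have hW₀ : FinMeets W ∅ := by
    intro F hF U _ k
    obtain rfl : F = ∅ := by simpa using hF
    exact ⟨q, by simp, hVW k (hb.1 q k).2⟩
  obtain ⟨H, hHe, hH⟩ := he W hW₀
  have hHA : H ⊆ A := by
    refine hHe.trans ?_
    rintro _ ⟨n, rfl⟩
    exact hA (l, n) f hfA
  have hins : FinMeets W (insert q H) :=
    hH.prop.insert_of_subset hb hVW hf hHA
  exact hHA (hH.le_of_ge hins (subset_insert _ _) (mem_insert _ _))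

theorem statement0 (X : Type*) [TopologicalSpace X] [Infinite X] :
    #X ≤ nh X ^ (cellularity X * character X) := by
  have hc : cellularity X ≤ cellularity X * character X :=
    le_mul_of_one_le_right' (one_le_character X)
  have hχ : character X ≤ cellularity X * character X :=
    le_mul_of_one_le_left' (one_le_aleph0.trans (aleph0_le_cellularity X))
  have : Infinite (cellularity X * character X).out := by
    rw [infinite_iff, mk_out]
    exact (aleph0_le_cellularity X).trans hc
  simpa only [mk_out] using mk_le_nh_power (X := X) (K := (cellularity X * character X).out)
    (by rwa [mk_out]) (by rwa [mk_out])
end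

section
/- Let X be an infinite T1 topological space. Then |X| ≤ 2^(nu_s(X)·2^(s(X))) (cardinal arithmetic). -/
open Cardinal Set

universe u

/-- In any space, an open neighbourhood assignment on `Y` admits a discrete `D ⊆ Y` such that
`Y` is covered by the closure of `D` and the neighbourhoods of the points of `D`. -/
theorem exists_discrete_subset_closure_union {X : Type u} [TopologicalSpace X] (Y : Set X)
    (W : X → Set X) (hW : ∀ q ∈ Y, IsOpen (W q) ∧ q ∈ W q) :
    ∃ D ⊆ Y, DiscreteTopology D ∧ ∀ y ∈ Y, y ∈ closure D ∨ ∃ q ∈ D, y ∈ W q := by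
  have wf : WellFounded (WellOrderingRel : X → X → Prop) := IsWellFounded.wf
  let F : (x : X) → ((y : X) → WellOrderingRel y x → Prop) → Prop := fun x P =>
    x ∈ Y ∧ x ∉ closure {d | ∃ h : WellOrderingRel d x, P d h} ∧
      ∀ d (h : WellOrderingRel d x), P d h → x ∉ W d
  let D : Set X := {x | wf.fix F x}
  have hD (x : X) : x ∈ D ↔ x ∈ Y ∧ x ∉ closure {d | WellOrderingRel d x ∧ d ∈ D} ∧
      ∀ d, WellOrderingRel d x → d ∈ D → x ∉ W d := by
    change wf.fix F x ↔ _
    rw [wf.fix_eq]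
    simp only [F, D, mem_ofPred_eq, exists_prop]
  refine ⟨D, fun x hx => ((hD x).1 hx).1, ?_, fun y hy => ?_⟩
  · refine discreteTopology_subtype_iff'.2 fun q hq => ?_
    obtain ⟨hqY, hqc, -⟩ := (hD q).1 hq
    refine ⟨W q ∩ (closure {d | WellOrderingRel d q ∧ d ∈ D})ᶜ,
      (hW q hqY).1.inter isClosed_closure.isOpen_compl, ?_⟩
    ext z
    constructor
    · rintro ⟨⟨hzW, hzc⟩, hz⟩
      rcases trichotomous_of WellOrderingRel z q with h | h | h
      · exact (hzc (subset_closure ⟨h, hz⟩)).elim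
      · exact h
      · exact absurd hzW (((hD z).1 hz).2.2 q h hq)
    · rintro rfl
      exact ⟨⟨(hW z hqY).2, hqc⟩, hq⟩
  · by_contra! h
    refine h.1 (subset_closure ((hD y).2 ⟨hy, fun hc => h.1 ?_, fun d _ hd => h.2 d hd⟩))
    exact closure_mono (fun d hd => hd.2) hc

/-- A space in which discrete subsets have size at most `#Λ` and points are intersections of `#Λ`
open sets has size at most `2 ^ #Λ`. -/
theorem mk_le_two_power_of_pseudobase {X Λ : Type u} [TopologicalSpace X] [Infinite Λ]
    (hs : ∀ D : Set X, DiscreteTopology D → #D ≤ #Λ)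
    (V : X → Λ → Set X) (hVo : ∀ x i, IsOpen (V x i)) (hV : ∀ x, ⋂ i, V x i = {x}) :
    #X ≤ 2 ^ #Λ := by
  have hΛ : ℵ₀ ≤ #Λ := aleph0_le_mk Λ
  rcases isEmpty_or_nonempty X with hX | hX
  · simp
  let β : Option ((Λ → Set Λ) × Set (Λ × Λ)) → Type u := fun o => o.elim PEmpty fun _ => Λ
  let B : (Λ → Set Λ) × Set (Λ × Λ) → (Λ → X) → Set X := fun a f =>
    (⋃ i, closure (f '' a.1 i)) ∪ ⋃ r ∈ a.2, V (f r.1) r.2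
  let step : (Σ o, β o → X) → X := fun
    | ⟨none, _⟩ => Classical.arbitrary X
    | ⟨some a, f⟩ => Classical.epsilon fun x => x ∉ B a f
  let val : WType β → X := WType.elim X step
  have hcard : #(WType β) ≤ 2 ^ #Λ := by
    have hcode : #(Option ((Λ → Set Λ) × Set (Λ × Λ))) ≤ 2 ^ #Λ := by
      have h2 : ℵ₀ ≤ (2 : Cardinal) ^ #Λ := hΛ.trans (cantor _).le
      simp only [mk_option, mk_prod, lift_id, mk_pi, mk_set, prod_const, ← power_mul,
        mul_eq_self hΛ, mul_eq_self h2]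
      rw [add_one_eq h2]
    refine WType.cardinalMk_le_of_le ?_
    calc sum (fun o => (2 ^ #Λ : Cardinal.{u}) ^ #(β o))
        ≤ sum (fun _ : Option ((Λ → Set Λ) × Set (Λ × Λ)) => (2 ^ #Λ : Cardinal.{u})) := by
          refine sum_le_sum _ _ fun o => ?_
          rw [← power_mul]
          refine power_le_power_left two_ne_zero ?_
          rcases o with _ | a
          · simp [β]
          · exact (mul_eq_self hΛ).le
      _ ≤ 2 ^ #Λ := by
          rw [sum_const, lift_id, lift_id]
          refine (mul_le_mul_left hcode _).trans ?_
          rw [← power_add, add_eq_self hΛ]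
  suffices hsurj : Function.Surjective val from (mk_le_of_surjective hsurj).trans hcard
  by_contra hns
  obtain ⟨p, hp⟩ : ∃ p, ∀ t, val t ≠ p := by simpa [Function.Surjective] using hns
  have hW : ∀ q, ∃ j, q ≠ p → p ∉ V q j := fun q => by
    by_contra! h
    have : p ∈ ⋂ i, V q i := mem_iInter.2 fun i => (h i).2
    rw [hV] at this
    exact (h (Classical.arbitrary Λ)).1 this.symm
  choose j hj using hW
  have hmem (x i) : x ∈ V x i := by
    have : x ∈ ⋂ i, V x i := by rw [hV]; rfl
    exact mem_iInter.1 this i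
  choose D hDY hDd hDc using fun i => exists_discrete_subset_closure_union
    (range val ∩ (V p i)ᶜ) (fun q => V q (j q)) fun q _ => ⟨hVo _ _, hmem _ _⟩
  have hA : #(⋃ i, D i) ≤ #Λ := by
    refine (mk_iUnion_le _).trans ?_
    exact (mul_le_mul' le_rfl (ciSup_le' fun i => hs _ (hDd i))).trans (mul_eq_self hΛ).le
  obtain ⟨t, ht⟩ : ∃ t : Λ → WType β, ⋃ i, D i ⊆ range (val ∘ t) := by
    obtain ⟨e⟩ := hA
    have hex : ∀ a : ⋃ i, D i, ∃ w, val w = a := fun a => by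
      obtain ⟨i, hi⟩ := mem_iUnion.1 a.2
      exact (hDY i hi).1
    choose w hw using hex
    let w₀ : WType β := ⟨none, PEmpty.elim⟩
    refine ⟨Function.extend e w fun _ => w₀, fun a ha => ⟨e ⟨a, ha⟩, ?_⟩⟩
    rw [Function.comp_apply, e.injective.extend_apply, hw]
  set f : Λ → X := val ∘ t
  let a : (Λ → Set Λ) × Set (Λ × Λ) := ⟨fun i => {γ | f γ ∉ V p i}, {r | p ∉ V (f r.1) r.2}⟩
  have hpB : p ∉ B a f := by
    rintro (h | h)
    · obtain ⟨i, hi⟩ := mem_iUnion.1 h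
      have hsub : f '' a.1 i ⊆ (V p i)ᶜ := by
        rintro _ ⟨γ, hγ, rfl⟩
        exact hγ
      exact closure_minimal hsub (hVo p i).isClosed_compl hi (hmem p i)
    · obtain ⟨r, hr, hpr⟩ := mem_iUnion₂.1 h
      exact hr hpr
  let y : X := val ⟨some a, t⟩
  have hyB : y ∉ B a f := Classical.epsilon_spec (p := fun x => x ∉ B a f) ⟨p, hpB⟩
  obtain ⟨i, hi⟩ : ∃ i, y ∉ V p i := by
    by_contra! h
    have : y ∈ ⋂ i, V p i := mem_iInter.2 h
    rw [hV] at this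
    exact hp _ this
  refine hyB ?_
  rcases hDc i y ⟨⟨_, rfl⟩, hi⟩ with h | ⟨q, hq, hyq⟩
  · refine Or.inl (mem_iUnion.2 ⟨i, closure_mono (fun d hd => ?_) h⟩)
    obtain ⟨γ, hγ⟩ := ht (mem_iUnion.2 ⟨i, hd⟩)
    refine ⟨γ, ?_, hγ⟩
    change f γ ∉ V p i
    rw [hγ]
    exact (hDY i hd).2
  · obtain ⟨γ, rfl⟩ := ht (mem_iUnion.2 ⟨i, hq⟩)
    exact Or.inr (mem_iUnion₂.2 ⟨(γ, j (f γ)), hj _ (hp _), hyq⟩)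

theorem mk_le_spread {X : Type u} [TopologicalSpace X] (D : Set X) (hD : DiscreteTopology D) :
    #D ≤ spread X :=
  (le_ciSup (f := fun D : {D : Set X // DiscreteTopology D} => #D.1) bddAbove_of_small
    ⟨D, hD⟩).trans le_add_self

theorem mk_thetaClosSingleton_le_nuS {X : Type u} [TopologicalSpace X] (x : X) :
    #(thetaClosSingleton X x) ≤ nuS X :=
  (le_ciSup (f := fun x : X => #(thetaClosSingleton X x)) bddAbove_of_small x).trans
    le_add_self

/-- In a `T₁` space every point is the intersection of at most `nuS X * 2 ^ spread X` open sets. -/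
theorem exists_pseudobase {X Λ : Type u} [TopologicalSpace X] [T1Space X]
    (hΛ : #Λ = nuS X * 2 ^ spread X) (x : X) :
    ∃ V : Λ → Set X, (∀ i, IsOpen (V i)) ∧ ⋂ i, V i = {x} := by
  classical
  have hsω : ℵ₀ ≤ spread X := le_self_add
  have hν : 1 ≤ nuS X := le_self_add
  have h2Λ : 2 ^ spread X ≤ #Λ := by
    rw [hΛ]; simpa using mul_le_mul_left hν (2 ^ spread X)
  have hνΛ : nuS X ≤ #Λ := by
    rw [hΛ]
    exact le_mul_of_one_le_right' (one_lt_aleph0.le.trans (hsω.trans (cantor _).le))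
  have hsΛ : spread X ≤ #Λ := (cantor _).le.trans h2Λ
  have hωΛ : ℵ₀ ≤ #Λ := hsω.trans hsΛ
  have hW : ∀ q, ∃ U : Set X, q ∈ (thetaClosSingleton X x)ᶜ →
      (IsOpen U ∧ q ∈ U) ∧ x ∉ closure U := fun q => by
    by_contra! h
    exact (h ∅).1 fun U hU hq => (h U).2 ⟨hU, hq⟩
  choose W hW using hW
  obtain ⟨D, hDY, hDd, hDc⟩ := exists_discrete_subset_closure_union (thetaClosSingleton X x)ᶜ W
    fun q hq => (hW q hq).1
  let V : D ⊕ Set D ⊕ thetaClosSingleton X x → Set X := fun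
    | .inl q => (closure (W q))ᶜ
    | .inr (.inl A) => if x ∈ closure ((↑) '' A : Set X) then univ else (closure ((↑) '' A))ᶜ
    | .inr (.inr y) => if (y : X) = x then univ else {(y : X)}ᶜ
  have hVo : ∀ i, IsOpen (V i) ∧ x ∈ V i := by
    rintro (q | A | y)
    · exact ⟨isClosed_closure.isOpen_compl, (hW q (hDY q.2)).2⟩
    · by_cases h : x ∈ closure ((↑) '' A : Set X)
      · simp [V, h]
      · simp [V, h]
    · by_cases h : (y : X) = x
      · simp [V, h]
      · simp [V, h, Ne.symm h]
  have hVx : ∀ y, (∀ i, y ∈ V i) → y = x := by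
    intro y hy
    by_contra hne
    by_cases hyθ : y ∈ thetaClosSingleton X x
    · simpa [V, hne] using hy (.inr (.inr ⟨y, hyθ⟩))
    · rcases hDc y hyθ with h | ⟨q, hq, hyq⟩
      · obtain ⟨⟨hWo, hyW⟩, hxW⟩ := hW y hyθ
        have himg : ((↑) '' ((↑) ⁻¹' W y : Set D) : Set X) = W y ∩ D := by
          rw [Subtype.image_preimage_coe, inter_comm]
        have hx : x ∉ closure (W y ∩ D) := fun h' => hxW (closure_mono inter_subset_left h')
        have := hy (.inr (.inl ((↑) ⁻¹' W y)))
        simp only [V, himg, hx, if_false] at this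
        exact this (hWo.inter_closure ⟨hyW, h⟩)
      · exact hy (.inl ⟨q, hq⟩) (subset_closure hyq)
  have hI : #(D ⊕ Set D ⊕ thetaClosSingleton X x) ≤ #Λ := by
    have hD := mk_le_spread D hDd
    simp only [mk_sum, lift_id, mk_set]
    exact add_le_of_le hωΛ (hD.trans hsΛ) (add_le_of_le hωΛ
      ((power_le_power_left two_ne_zero hD).trans h2Λ)
      ((mk_thetaClosSingleton_le_nuS x).trans hνΛ))
  obtain ⟨e⟩ := hI
  have : Nonempty (D ⊕ Set D ⊕ thetaClosSingleton X x) := ⟨.inr (.inl ∅)⟩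
  have hsurj := Function.invFun_surjective e.injective
  refine ⟨V ∘ Function.invFun e, fun i => (hVo _).1, ?_⟩
  ext y
  rw [mem_iInter, mem_singleton_iff]
  refine ⟨fun h => hVx y fun i => ?_, ?_⟩
  · obtain ⟨k, rfl⟩ := hsurj i
    exact h k
  · rintro rfl i
    exact (hVo _).2

theorem statement2 (X : Type*) [TopologicalSpace X] [T1Space X] [Infinite X] :
    #X ≤ 2 ^ (nuS X * 2 ^ spread X) := by
  have hΛ : #(nuS X * 2 ^ spread X).out = nuS X * 2 ^ spread X := mk_out _
  have hν : 1 ≤ nuS X := le_self_add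
  have hsΛ : spread X ≤ #(nuS X * 2 ^ spread X).out := by
    rw [hΛ]
    refine (cantor _).le.trans ?_
    simpa using mul_le_mul_left hν (2 ^ spread X)
  have hω : ℵ₀ ≤ spread X := le_self_add
  have : Infinite (nuS X * 2 ^ spread X).out := infinite_iff.2 (hω.trans hsΛ)
  choose V hVo hV using exists_pseudobase (X := X) hΛ
  rw [← hΛ]
  exact mk_le_two_power_of_pseudobase (fun D hD => (mk_le_spread D hD).trans hsΛ) V hVo hV
end

section
/- Let X be an infinite T1 topological space. Then |X| ≤ 2^(nu(X)·2^(s(X))) (cardinal arithmetic). -/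
open Cardinal Set

/-- A set each of whose points has an open neighborhood isolating it has size at most the
spread. -/
theorem mk_le_spread_s4 {X : Type*} [TopologicalSpace X] {D : Set X}
    (h : ∀ y ∈ D, ∃ U, IsOpen U ∧ y ∈ U ∧ ∀ z ∈ D, z ∈ U → z = y) : #D ≤ spread X := by
  have hD : DiscreteTopology D := by
    rw [discreteTopology_iff_isOpen_singleton]
    rintro ⟨y, hy⟩
    obtain ⟨U, hU, hyU, hz⟩ := h y hy
    refine ⟨U, hU, ?_⟩
    ext ⟨z, hzD⟩
    simp only [mem_preimage, mem_singleton_iff, Subtype.mk.injEq]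
    exact ⟨hz z hzD, fun e => e ▸ hyU⟩
  exact (le_ciSup (f := fun D : {D : Set X // DiscreteTopology D} => #D.1)
    (bddAbove_of_small) ⟨D, hD⟩).trans le_add_self

theorem aleph0_le_spread (X : Type*) [TopologicalSpace X] : ℵ₀ ≤ spread X :=
  le_self_add

theorem mk_le_nu {X : Type*} [TopologicalSpace X] {A : Set X} (h : FinNonUrysohn X A) :
    #A ≤ nu X :=
  (le_ciSup (f := fun A : {A : Set X // FinNonUrysohn X A} => #A.1)
    (bddAbove_of_small) ⟨A, h⟩).trans le_add_self

theorem finNonUrysohn_thetaClosSingleton {X : Type*} [TopologicalSpace X] (p : X) :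
    FinNonUrysohn X (thetaClosSingleton X p) := by
  refine ⟨⟨p, fun U _ hp => subset_closure hp⟩, fun F hF _ U hU => ⟨p, ?_⟩⟩
  simp only [mem_iInter]
  exact fun x hx => hF hx (U x) (hU x hx).1 (hU x hx).2

/-- Šapirovskiĭ's lemma: a neighborhood assignment on `S` covers `S` up to the closure of a
subset of size at most the spread. -/
theorem exists_subset_closure_union_iUnion {X : Type*} [TopologicalSpace X] (S : Set X)
    (V : X → Set X) (hV : ∀ y ∈ S, IsOpen (V y) ∧ y ∈ V y) :
    ∃ A ⊆ S, #A ≤ spread X ∧ S ⊆ closure A ∪ ⋃ a ∈ A, V a := by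
  let r : X → X → Prop := WellOrderingRel
  have wf : WellFounded r := IsWellFounded.wf
  let Q : X → Prop := wf.fix fun y ih =>
    y ∈ S ∧ y ∉ closure {a | ∃ h : r a y, ih a h} ∧ ∀ a, ∀ h : r a y, ih a h → y ∉ V a
  have hQ : ∀ y, Q y ↔
      y ∈ S ∧ y ∉ closure {a | r a y ∧ Q a} ∧ ∀ a, r a y → Q a → y ∉ V a := by
    intro y
    have := wf.fix_eq (C := fun _ => Prop) (fun y ih =>
      y ∈ S ∧ y ∉ closure {a | ∃ h : r a y, ih a h} ∧ ∀ a, ∀ h : r a y, ih a h → y ∉ V a) y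
    simp only [exists_prop] at this
    exact iff_of_eq this
  refine ⟨{y | Q y}, fun y hy => ((hQ y).1 hy).1, mk_le_spread_s4 fun y hy => ?_, fun y hy => ?_⟩
  · obtain ⟨hyS, hcl, -⟩ := (hQ y).1 hy
    refine ⟨V y ∩ (closure {a | r a y ∧ Q a})ᶜ, (hV y hyS).1.inter isClosed_closure.isOpen_compl,
      ⟨(hV y hyS).2, hcl⟩, fun z hz hzU => ?_⟩
    rcases trichotomous_of r z y with h | h | h
    · exact absurd (subset_closure (show z ∈ {a | r a y ∧ Q a} from ⟨h, hz⟩)) hzU.2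
    · exact h
    · exact absurd hzU.1 (((hQ z).1 hz).2.2 y h hy)
  · by_contra hn
    simp only [mem_union, mem_iUnion, not_or, not_exists] at hn
    refine hn.1 (subset_closure ((hQ y).2 ⟨hy, fun h => hn.1 ?_, fun a _ ha => hn.2 a ha⟩))
    exact closure_mono (fun a ha => ha.2) h

/-- In a `T₁` space every point is the intersection of at most `nu X * 2 ^ spread X` open
sets. -/
theorem exists_pseudobase_s4 {X : Type u} [TopologicalSpace X] [T1Space X] {L : Type u}
    (hL : nu X * 2 ^ spread X ≤ #L) (p : X) :
    ∃ B : L → Set X, (∀ l, IsOpen (B l) ∧ p ∈ B l) ∧ ∀ y, y ≠ p → ∃ l, y ∉ B l := by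
  classical
  have hsep : ∀ y, ∃ V : Set X, IsOpen V ∧ y ∈ V ∧
      (y ∉ thetaClosSingleton X p → p ∉ closure V) := by
    intro y
    by_cases hy : y ∈ thetaClosSingleton X p
    · exact ⟨univ, isOpen_univ, mem_univ y, fun h => absurd hy h⟩
    · simp only [thetaClosSingleton, mem_ofPred_eq, not_forall] at hy
      obtain ⟨V, hV, hyV, hp⟩ := hy
      exact ⟨V, hV, hyV, fun _ => hp⟩
  choose V hVo hyV hpV using hsep
  obtain ⟨A, hAS, hA, hcov⟩ := exists_subset_closure_union_iUnion
    (thetaClosSingleton X p)ᶜ V fun y _ => ⟨hVo y, hyV y⟩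
  let G : thetaClosSingleton X p ⊕ (A ⊕ Set A) → Set X :=
    Sum.elim (fun y => {y.1}ᶜ)
      (Sum.elim (fun a => (closure (V a))ᶜ) (fun B => (closure (Subtype.val '' B))ᶜ))
  have hcard : #(thetaClosSingleton X p ⊕ (A ⊕ Set A)) ≤ #L := by
    refine le_trans ?_ hL
    have hs := aleph0_le_spread X
    have hn : 1 ≤ nu X := le_self_add
    have h2 : ℵ₀ ≤ 2 ^ spread X := hs.trans (cantor _).le
    have hm : ℵ₀ ≤ nu X * 2 ^ spread X := h2.trans (le_mul_of_one_le_left' hn)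
    have hle : 2 ^ spread X ≤ nu X * 2 ^ spread X := le_mul_of_one_le_left' hn
    simp only [mk_sum, mk_set, lift_id]
    refine add_le_of_le hm ?_ (add_le_of_le hm ?_ ?_)
    · exact (mk_le_nu (finNonUrysohn_thetaClosSingleton p)).trans
        (le_mul_of_one_le_right' (one_le_aleph0.trans h2))
    · exact hA.trans ((cantor _).le.trans hle)
    · exact (power_le_power_left two_ne_zero hA).trans hle
  obtain ⟨e⟩ := hcard
  let G' : thetaClosSingleton X p ⊕ (A ⊕ Set A) → Set X := fun i => if p ∈ G i then G i else univ
  have hGo : ∀ i, IsOpen (G i) := by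
    rintro (y | a | B)
    · exact isOpen_compl_singleton
    · exact isClosed_closure.isOpen_compl
    · exact isClosed_closure.isOpen_compl
  have hex : ∀ y, (∃ i, p ∈ G i ∧ y ∉ G i) →
      ∃ l, y ∉ Function.extend e G' (fun _ => univ) l := by
    rintro y ⟨i, hp, hy⟩
    refine ⟨e i, ?_⟩
    rw [e.injective.extend_apply]
    simpa [G', hp] using hy
  refine ⟨Function.extend e G' (fun _ => univ), fun l => ?_, fun y hy => hex y ?_⟩
  · by_cases hl : ∃ i, e i = l
    · obtain ⟨i, rfl⟩ := hl
      rw [e.injective.extend_apply]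
      by_cases hp : p ∈ G i
      · simpa [G', hp] using hGo i
      · simp [G', hp]
    · rw [Function.extend_apply' _ _ _ hl]
      exact ⟨isOpen_univ, mem_univ p⟩
  · by_cases hyN : y ∈ thetaClosSingleton X p
    · exact ⟨Sum.inl ⟨y, hyN⟩, by simpa [G] using hy.symm, by simp [G]⟩
    · rcases hcov hyN with hcl | hU
      · refine ⟨Sum.inr (Sum.inr {a | a.1 ∈ V y}), fun hp => hpV y hyN ?_, fun hn => hn ?_⟩
        · refine closure_mono ?_ hp
          rintro _ ⟨a, ha, rfl⟩
          exact ha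
        · have := (hVo y).inter_closure ⟨hyV y, hcl⟩
          refine closure_mono ?_ this
          rintro a ⟨haV, haA⟩
          exact ⟨⟨a, haA⟩, haV, rfl⟩
      · simp only [mem_iUnion] at hU
        obtain ⟨a, ha, hya⟩ := hU
        exact ⟨Sum.inr (Sum.inl ⟨a, ha⟩), hpV a (hAS ha), fun hn => hn (subset_closure hya)⟩

/-- The end-homogeneous form of the Erdős–Rado theorem for pairs. -/
theorem exists_endHomogeneous {X C : Type u} (c : Cardinal.{u}) (hc : ℵ₀ ≤ c) (hC : #C ≤ c)
    (hX : 2 ^ c < #X) (f : X → X → C) :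
    ∃ (y : (Order.succ c).ord.ToType → X) (g : (Order.succ c).ord.ToType → C),
      ∀ β α, β < α → y β ≠ y α ∧ f (y β) (y α) = g β := by
  classical
  let W := (Order.succ c).ord.ToType
  have : Nonempty X := mk_ne_zero_iff.1 (ne_bot_of_gt hX)
  let pick : Set (X × C) → X := fun T =>
    Classical.epsilon fun z => ∀ q ∈ T, q.1 ≠ z ∧ f q.1 z = q.2
  have hpick : ∀ T, (∃ z, ∀ q ∈ T, q.1 ≠ z ∧ f q.1 z = q.2) →
      ∀ q ∈ T, q.1 ≠ pick T ∧ f q.1 (pick T) = q.2 := fun T h => Classical.epsilon_spec h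
  have wf : WellFounded ((· < ·) : W → W → Prop) := wellFounded_lt
  let y : X → W → X := fun x => wf.fix fun α ih =>
    pick {q | ∃ β, ∃ h : β < α, q = (ih β h, f (ih β h) x)}
  have hy : ∀ x α, y x α = pick {q | ∃ β, ∃ _ : β < α, q = (y x β, f (y x β) x)} :=
    fun x α => wf.fix_eq (C := fun _ => X) (fun α ih =>
      pick {q | ∃ β, ∃ h : β < α, q = (ih β h, f (ih β h) x)}) α
  by_cases hx : ∃ x, ∀ α, y x α ≠ x
  · obtain ⟨x, hx⟩ := hx
    refine ⟨y x, fun β => f (y x β) x, fun β α hβ => ?_⟩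
    rw [hy x α]
    refine hpick {q | ∃ β, ∃ _ : β < α, q = (y x β, f (y x β) x)} ⟨x, ?_⟩
      (y x β, f (y x β) x) ⟨β, hβ, rfl⟩
    rintro _ ⟨γ, _, rfl⟩
    exact ⟨hx γ, rfl⟩
  · push Not at hx
    choose a ha using hx
    exfalso
    let Φ : X → Σ α : W, (Iio α → C) := fun x => ⟨a x, fun β => f (y x β) x⟩
    have key : ∀ x x' α, (∀ β < α, f (y x β) x = f (y x' β) x') → ∀ β ≤ α, y x β = y x' β := by
      intro x x' α h β
      induction β using wf.induction with
      | _ β ih =>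
        intro hβ
        rw [hy x β, hy x' β]
        congr 1
        ext q
        refine exists_congr fun γ => exists_congr fun hγ => ?_
        rw [h γ (hγ.trans_le hβ), ih γ hγ (hγ.le.trans hβ)]
    have hΦ : Function.Injective Φ := by
      intro x x' h
      have h1 : a x = a x' := congrArg Sigma.fst h
      have h2 : ∀ β < a x, f (y x β) x = f (y x' β) x' := by
        have h3 : ∀ (s t : Σ α : W, (Iio α → C)), s = t → ∀ β (hs : β < s.1) (ht : β < t.1),
            s.2 ⟨β, hs⟩ = t.2 ⟨β, ht⟩ := by
          rintro s _ rfl β _ _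
          rfl
        exact fun β hβ => h3 _ _ h β hβ (hβ.trans_eq h1)
      rw [← ha x, ← ha x', ← h1]
      exact key x x' (a x) h2 (a x) le_rfl
    refine (mk_le_of_injective hΦ).not_gt (lt_of_le_of_lt ?_ hX)
    have h2c : ℵ₀ ≤ 2 ^ c := hc.trans (cantor c).le
    have hW : #W ≤ 2 ^ c := by
      rw [mk_ord_toType]
      exact Order.succ_le_of_lt (cantor c)
    rw [mk_sigma]
    calc Cardinal.sum (fun α : W => #(Iio α → C)) ≤ Cardinal.sum (fun _ : W => (2 : Cardinal) ^ c) := by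
          refine sum_le_sum _ _ fun α => ?_
          have hα : #(Iio α) ≤ c := Order.lt_succ_iff.1 <|
            (mk_Iio_lt α (by rw [mk_ord_toType, Ordinal.type_toType])).trans_eq (mk_ord_toType _)
          rw [← power_def]
          calc #C ^ #(Iio α) ≤ c ^ #(Iio α) := power_le_power_right hC
            _ ≤ c ^ c := power_le_power_left (aleph0_pos.trans_le hc).ne' hα
            _ = 2 ^ c := power_self_eq hc
      _ = #W * 2 ^ c := by simp
      _ ≤ 2 ^ c := mul_le_of_le h2c hW le_rfl

theorem statement4 (X : Type*) [TopologicalSpace X] [T1Space X] [Infinite X] :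
    #X ≤ 2 ^ (nu X * 2 ^ spread X) := by
  classical
  by_contra! hX
  set c := nu X * 2 ^ spread X with hcdef
  have hsc : spread X < c :=
    (cantor _).trans_le (le_mul_of_one_le_left' le_self_add)
  have hc : ℵ₀ ≤ c := (aleph0_le_spread X).trans hsc.le
  have hL : c ≤ #c.out := (mk_out c).ge
  choose B hB hBsep using fun p : X => exists_pseudobase_s4 (L := c.out) hL p
  have : Nonempty c.out := mk_ne_zero_iff.1 (by rw [mk_out]; exact (aleph0_pos.trans_le hc).ne')
  have hcol : ∀ a b : X, ∃ q : c.out × c.out, a ≠ b → b ∉ B a q.1 ∧ a ∉ B b q.2 := by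
    intro a b
    by_cases h : a = b
    · exact ⟨Classical.arbitrary _, fun h' => absurd h h'⟩
    · obtain ⟨i, hi⟩ := hBsep a b (Ne.symm h)
      obtain ⟨j, hj⟩ := hBsep b a h
      exact ⟨(i, j), fun _ => ⟨hi, hj⟩⟩
  choose f hf using hcol
  have hC : #(c.out × c.out) ≤ c := by simp [mul_eq_self hc]
  obtain ⟨y, g, hyg⟩ := exists_endHomogeneous c hc hC hX f
  have hinj : Function.Injective y := by
    intro α β h
    rcases lt_trichotomy α β with h' | h' | h'
    · exact absurd h (hyg _ _ h').1
    · exact h'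
    · exact absurd h.symm (hyg _ _ h').1
  obtain ⟨q, hq⟩ : ∃ q, c < #(g ⁻¹' {q}) := by
    by_contra! hq
    have h1 : #(Order.succ c).ord.ToType ≤ c := by
      rw [← mk_univ, ← preimage_univ (f := g), ← iUnion_of_singleton, preimage_iUnion]
      exact (mk_iUnion_le _).trans (mul_le_of_le hc hC (ciSup_le' hq))
    rw [mk_ord_toType] at h1
    exact h1.not_gt (Order.lt_succ c)
  have hle : #(y '' (g ⁻¹' {q})) ≤ spread X := by
    refine mk_le_spread_s4 ?_
    rintro _ ⟨α, hα, rfl⟩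
    refine ⟨B (y α) q.1 ∩ B (y α) q.2, (hB _ _).1.inter (hB _ _).1,
      ⟨(hB _ _).2, (hB _ _).2⟩, ?_⟩
    rintro _ ⟨β, hβ, rfl⟩ hU
    have hα' : g α = q := hα
    have hβ' : g β = q := hβ
    rcases lt_trichotomy α β with h | h | h
    · have h1 := hf _ _ (hyg _ _ h).1
      rw [(hyg _ _ h).2, hα'] at h1
      exact absurd hU.1 h1.1
    · rw [h]
    · have h1 := hf _ _ (hyg _ _ h).1
      rw [(hyg _ _ h).2, hβ'] at h1
      exact absurd hU.2 h1.2
  rw [mk_image_eq hinj] at hle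
  exact (hq.trans_le hle).not_gt hsc
end

section
/- Let X be a topological space and A a maximal finitely non-Hausdorff subset of X. Then A = ⋂ { cl(⋂{U_x : x ∈ F}) : F a nonempty finite subset of A, and {U_x : x ∈ F} a family with each U_x an open neighborhood of x }. -/
open Cardinal Set

theorem statement10 (X : Type*) [TopologicalSpace X] (A : Set X)
    (hA : MaxFinNonHausdorff X A) :
    A = ⋂ (F : Finset X) (_ : (F : Set X) ⊆ A ∧ F.Nonempty)
        (U : X → Set X) (_ : ∀ x ∈ F, IsOpen (U x) ∧ x ∈ U x),
      closure (⋂ x ∈ F, U x) := by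
  classical
  obtain ⟨⟨hne, hfin⟩, hmax⟩ := hA
  apply Subset.antisymm
  · intro x hx
    simp only [mem_iInter]
    rintro F ⟨hFA, -⟩ U hU
    rw [mem_closure_iff]
    intro V hV hxV
    obtain ⟨z, hz⟩ := hfin (insert x F)
      (by rw [Finset.coe_insert]; exact insert_subset hx hFA) (Finset.insert_nonempty x F)
      (fun y => (if y = x then V else univ) ∩ (if y ∈ F then U y else univ)) (by
        intro y _
        constructor
        · apply IsOpen.inter
          · split_ifs
            exacts [hV, isOpen_univ]
          · split_ifs with h
            exacts [(hU y h).1, isOpen_univ]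
        · constructor
          · split_ifs with h
            exacts [h ▸ hxV, mem_univ y]
          · split_ifs with h
            exacts [(hU y h).2, mem_univ y])
    rw [mem_iInter₂] at hz
    refine ⟨z, by simpa using (hz x (Finset.mem_insert_self x F)).1, mem_iInter₂.2 fun y hy => ?_⟩
    simpa [hy] using (hz y (Finset.mem_insert_of_mem hy)).2
  · intro x hx
    simp only [mem_iInter] at hx
    have hB : FinNonHausdorff X (insert x A) := by
      refine ⟨insert_nonempty x A, fun F hF hFne U hU => ?_⟩
      by_cases hxF : x ∈ F
      · have hsub : ((F.erase x : Finset X) : Set X) ⊆ A := by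
          intro y hy
          obtain ⟨hyx, hyF⟩ := Finset.mem_erase.1 hy
          exact (hF hyF).resolve_left hyx
        rcases (F.erase x).eq_empty_or_nonempty with he | he
        · refine ⟨x, mem_iInter₂.2 fun y hy => ?_⟩
          rcases Finset.erase_eq_empty_iff F x |>.1 he with h | h
          · simp [h] at hxF
          · rw [h, Finset.mem_singleton] at hy
            exact hy ▸ (hU x hxF).2
        · obtain ⟨z, hzx, hz⟩ := mem_closure_iff.1
            (hx (F.erase x) ⟨hsub, he⟩ U fun y hy => hU y (Finset.mem_of_mem_erase hy))
            (U x) (hU x hxF).1 (hU x hxF).2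
          refine ⟨z, mem_iInter₂.2 fun y hy => ?_⟩
          by_cases hyx : y = x
          · exact hyx ▸ hzx
          · exact mem_iInter₂.1 hz y (Finset.mem_erase.2 ⟨hyx, hy⟩)
      · exact hfin F (fun y hy => (hF hy).resolve_left fun h => hxF (h ▸ hy)) hFne U hU
    rw [hmax _ hB (subset_insert x A)]
    exact mem_insert x A
end

section
/- Every maximal finitely non-Hausdorff subset of a topological space X is a closed subset of X. -/
open Cardinal Set

/-- The closure of a finitely non-Hausdorff subset is finitely non-Hausdorff. -/
theorem finNonHausdorff_closure {X : Type*} [TopologicalSpace X] {A : Set X}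
    (hA : FinNonHausdorff X A) : FinNonHausdorff X (closure A) := by
  classical
  refine ⟨hA.1.closure, fun F hF hne U hU => ?_⟩
  have key : ∀ x, ∃ a, x ∈ F → a ∈ U x ∧ a ∈ A := by
    intro x
    by_cases hx : x ∈ F
    · obtain ⟨a, ha⟩ := mem_closure_iff.1 (hF hx) (U x) (hU x hx).1 (hU x hx).2
      exact ⟨a, fun _ => ha⟩
    · exact ⟨x, fun h => absurd h hx⟩
  choose a ha using key
  obtain ⟨p, hp⟩ := hA.2 (F.image a)
    (by
      intro y hy
      obtain ⟨x, hx, rfl⟩ := Finset.mem_image.1 (Finset.mem_coe.1 hy)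
      exact (ha x hx).2)
    (hne.image a)
    (fun y => ⋂ x ∈ F.filter (fun x => a x = y), U x)
    (by
      intro y _
      refine ⟨isOpen_biInter_finset fun x hx => (hU x (Finset.mem_filter.1 hx).1).1, ?_⟩
      refine mem_iInter₂.2 fun x hx => ?_
      obtain ⟨hxF, rfl⟩ := Finset.mem_filter.1 hx
      exact (ha x hxF).1)
  refine ⟨p, mem_iInter₂.2 fun x hx => ?_⟩
  exact mem_iInter₂.1 (mem_iInter₂.1 hp (a x) (Finset.mem_image_of_mem a hx)) x
    (Finset.mem_filter.2 ⟨hx, rfl⟩)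

theorem statement11 (X : Type*) [TopologicalSpace X] (A : Set X)
    (hA : MaxFinNonHausdorff X A) : IsClosed A := by
  rw [hA.2 _ (finNonHausdorff_closure hA.1) subset_closure]
  exact isClosed_closure
end

section
/- Let X be a topological space and A a finitely non-Hausdorff subset of X. Then the closure cl(A) of A is also a finitely non-Hausdorff subset of X. -/
open Cardinal Set

theorem statement12 (X : Type*) [TopologicalSpace X] (A : Set X)
    (hA : FinNonHausdorff X A) : FinNonHausdorff X (closure A) := by
  classical
  refine ⟨hA.1.mono subset_closure, fun F hF hne U hU => ?_⟩
  have hmeet : ∀ x ∈ F, ∃ a ∈ A, a ∈ U x := fun x hx => by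
    obtain ⟨a, haU, haA⟩ := mem_closure_iff.1 (hF hx) (U x) (hU x hx).1 (hU x hx).2
    exact ⟨a, haA, haU⟩
  choose! p hpA hpU using hmeet
  obtain ⟨z, hz⟩ := hA.2 (F.image p)
    (fun a ha => by
      obtain ⟨x, hx, rfl⟩ := Finset.mem_image.1 ha
      exact hpA x hx)
    (hne.image p) (fun a => ⋂ x ∈ F.filter (fun x => p x = a), U x)
    (fun a _ => by
      refine ⟨isOpen_biInter_finset fun x hx => (hU x (Finset.mem_filter.1 hx).1).1,
        mem_iInter₂.2 fun x hx => ?_⟩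
      obtain ⟨hxF, rfl⟩ := Finset.mem_filter.1 hx
      exact hpU x hxF)
  refine ⟨z, mem_iInter₂.2 fun x hx => ?_⟩
  exact mem_iInter₂.1 (mem_iInter₂.1 hz (p x) (Finset.mem_image_of_mem p hx)) x
    (Finset.mem_filter.2 ⟨hx, rfl⟩)
end

section
/- Let X be a topological space and x ∈ X. Then ⋂{cl(U) : U an open neighborhood of x} = ⋃{M : M a maximal finitely non-Hausdorff subset of X with x ∈ M}. -/
open Cardinal Set

theorem FinNonHausdorff.exists_maximal {X : Type*} [TopologicalSpace X] {A : Set X}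
    (hA : FinNonHausdorff X A) : ∃ M, A ⊆ M ∧ MaxFinNonHausdorff X M := by
  obtain ⟨M, hAM, hM⟩ := zorn_subset_nonempty {B : Set X | FinNonHausdorff X B}
    (fun c hc hchain hne ↦ by
      obtain ⟨B, hB⟩ := hne
      refine ⟨⋃₀ c, ⟨(hc hB).1.mono (subset_sUnion_of_mem hB), fun F hF ↦ ?_⟩,
        fun s hs ↦ subset_sUnion_of_mem hs⟩
      obtain ⟨D, hD, hFD⟩ :=
        DirectedOn.exists_mem_subset_of_finset_subset_biUnion (f := id) ⟨B, hB⟩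
          hchain.directedOn (by simpa [sUnion_eq_biUnion] using hF)
      exact (hc hD).2 F hFD) A hA
  exact ⟨M, hAM, hM.prop, fun B hB hMB ↦ hM.eq_of_subset hB hMB⟩

theorem finNonHausdorff_pair {X : Type*} [TopologicalSpace X] {x y : X}
    (h : ∀ U : Set X, IsOpen U → x ∈ U → y ∈ closure U) : FinNonHausdorff X {x, y} := by
  classical
  refine ⟨insert_nonempty x {y}, fun F hF _ U hU ↦ ?_⟩
  let V : X → Set X := fun z ↦ if z ∈ F then U z else univ
  have hV (z : X) : IsOpen (V z) ∧ z ∈ V z := by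
    by_cases hz : z ∈ F
    · simpa [V, hz] using hU z hz
    · simp [V, hz]
  obtain ⟨p, hpy, hpx⟩ := mem_closure_iff.1 (h _ (hV x).1 (hV x).2) _ (hV y).1 (hV y).2
  refine ⟨p, mem_iInter₂.2 fun z hz ↦ ?_⟩
  rcases hF hz with rfl | rfl
  · simpa [V, Finset.mem_coe.1 hz] using hpx
  · simpa [V, Finset.mem_coe.1 hz] using hpy

theorem FinNonHausdorff.mem_closure {X : Type*} [TopologicalSpace X] {A : Set X}
    (hA : FinNonHausdorff X A) {x y : X} (hx : x ∈ A) (hy : y ∈ A) {U : Set X}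
    (hU : IsOpen U) (hxU : x ∈ U) : y ∈ closure U := by
  classical
  refine mem_closure_iff.2 fun W hW hyW ↦ ?_
  by_cases hxy : x = y
  · exact ⟨x, hxy ▸ hyW, hxU⟩
  obtain ⟨p, hp⟩ := hA.2 {x, y} (by simp [insert_subset_iff, hx, hy])
    (Finset.insert_nonempty x {y}) (fun z ↦ if z = x then U else W) (by
      simp [hU, hxU, hW, hyW, Ne.symm hxy])
  have hp' : p ∈ U ∧ p ∈ W := by simpa [Ne.symm hxy] using hp
  exact ⟨p, hp'.2, hp'.1⟩

theorem statement13 (X : Type*) [TopologicalSpace X] (x : X) :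
    (⋂ (U : Set X) (_ : IsOpen U ∧ x ∈ U), closure U) =
      ⋃ (M : Set X) (_ : MaxFinNonHausdorff X M ∧ x ∈ M), M := by
  ext y
  simp only [mem_iInter, mem_iUnion, exists_prop]
  constructor
  · intro h
    obtain ⟨M, hM, hmax⟩ :=
      (finNonHausdorff_pair fun U hU hxU ↦ h U ⟨hU, hxU⟩).exists_maximal
    exact ⟨M, ⟨hmax, hM (by simp)⟩, hM (by simp)⟩
  · rintro ⟨M, ⟨hM, hxM⟩, hyM⟩ U ⟨hU, hxU⟩
    exact hM.1.mem_closure hxM hyM hU hxU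
end

section
/- Let X be a topological space and x ∈ X a point such that cl(U) = X for every open neighborhood U of x. Then x ∈ M for every maximal finitely non-Hausdorff subset M of X. -/
open Cardinal Set

theorem statement19 (X : Type*) [TopologicalSpace X] (x : X)
    (hx : ∀ U : Set X, IsOpen U → x ∈ U → closure U = Set.univ)
    (M : Set X) (hM : MaxFinNonHausdorff X M) : x ∈ M := by
  classical
  obtain ⟨⟨-, hfin⟩, hmax⟩ := hM
  have key : FinNonHausdorff X (insert x M) := by
    refine ⟨⟨x, mem_insert x M⟩, fun F hF hFne U hU => ?_⟩
    by_cases hxF : x ∈ F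
    · have hinter : (⋂ y ∈ F.erase x, U y).Nonempty := by
        rcases (F.erase x).eq_empty_or_nonempty with he | hFe
        · rw [he]
          exact ⟨x, by simp⟩
        · refine hfin _ (fun y hy => ?_) hFe U fun y hy => hU y (Finset.mem_of_mem_erase hy)
          obtain ⟨hyx, hyF⟩ := Finset.mem_erase.mp hy
          exact (hF hyF).resolve_left hyx
      have hopen : IsOpen (⋂ y ∈ F.erase x, U y) :=
        isOpen_biInter_finset fun y hy => (hU y (Finset.mem_of_mem_erase hy)).1
      obtain ⟨z, hz, hzx⟩ :=
        (dense_iff_closure_eq.mpr (hx (U x) (hU x hxF).1 (hU x hxF).2)).inter_open_nonempty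
          _ hopen hinter
      refine ⟨z, mem_iInter₂.mpr fun y hy => ?_⟩
      by_cases hyx : y = x
      · exact hyx ▸ hzx
      · exact mem_iInter₂.mp hz y (Finset.mem_erase.mpr ⟨hyx, hy⟩)
    · refine hfin F (fun y hy => (hF hy).resolve_left ?_) hFne U hU
      rintro rfl
      exact hxF hy
  rw [hmax _ key (subset_insert x M)]
  exact mem_insert x M
end
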